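/- Let (X, 𝓑, μ) be a probability space, let T₁, …, T_k be pairwise commuting measurable measure-preserving maps on X, and let A ∈ 𝓑 with μ(A) > 0. Then for μ-almost every x ∈ A there is n ≥ 1 such that x ∈ ⋂_{1≤i≤k} T_i^{-n}(A). -/

import Mathlib

open MeasureTheory

namespace DensityHalesJewett

open Sum

/-- The average of a real-valued function on a finite type. -/
noncomputable def avg {X : Type*} (f : X → ℝ) : ℝ := (∑ᶠ x, f x) / Nat.card X

lemma avg_eq {X : Type*} [Fintype X] (f : X → ℝ) :
    avg f = (∑ x, f x) / Fintype.card X := by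
  rw [avg, finsum_eq_sum_of_fintype, Nat.card_eq_fintype_card]

lemma avg_equiv {X Y : Type*} (e : X ≃ Y) (f : Y → ℝ) : avg (fun x => f (e x)) = avg f := by
  rw [avg, avg, finsum_comp_equiv, Nat.card_congr e]

section avg

variable {X Y : Type*} [Finite X] [Finite Y]

lemma avg_add (f g : X → ℝ) : avg (fun x => f x + g x) = avg f + avg g := by
  have := Fintype.ofFinite X
  simp only [avg_eq, Finset.sum_add_distrib, add_div]

lemma avg_sub (f g : X → ℝ) : avg (fun x => f x - g x) = avg f - avg g := by
  have := Fintype.ofFinite X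
  simp only [avg_eq, Finset.sum_sub_distrib, sub_div]

lemma avg_const_mul (c : ℝ) (f : X → ℝ) : avg (fun x => c * f x) = c * avg f := by
  have := Fintype.ofFinite X
  simp only [avg_eq, ← Finset.mul_sum, mul_div_assoc]

lemma avg_sum {J : Type*} (s : Finset J) (f : J → X → ℝ) :
    avg (fun x => ∑ j ∈ s, f j x) = ∑ j ∈ s, avg (f j) := by
  have := Fintype.ofFinite X
  simp only [avg_eq, ← Finset.sum_div]
  rw [Finset.sum_comm]

@[simp]
lemma avg_const [Nonempty X] (c : ℝ) : avg (fun _ : X => c) = c := by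
  have := Fintype.ofFinite X
  simp [avg_eq]

lemma avg_mono {f g : X → ℝ} (h : ∀ x, f x ≤ g x) : avg f ≤ avg g := by
  have := Fintype.ofFinite X
  simp only [avg_eq]
  gcongr with x
  exact h x

lemma avg_nonneg {f : X → ℝ} (h : ∀ x, 0 ≤ f x) : 0 ≤ avg f := by
  have := Fintype.ofFinite X
  rw [avg_eq]
  exact div_nonneg (Finset.sum_nonneg fun x _ => h x) (Nat.cast_nonneg _)

lemma avg_le [Nonempty X] {f : X → ℝ} {c : ℝ} (h : ∀ x, f x ≤ c) : avg f ≤ c :=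
  (avg_mono h).trans (avg_const c).le

lemma le_avg [Nonempty X] {f : X → ℝ} {c : ℝ} (h : ∀ x, c ≤ f x) : c ≤ avg f :=
  (avg_const c).ge.trans (avg_mono h)

lemma avg_prod (f : X × Y → ℝ) : avg f = avg fun x => avg fun y => f (x, y) := by
  have := Fintype.ofFinite X
  have := Fintype.ofFinite Y
  simp only [avg_eq, Fintype.sum_prod_type, Fintype.card_prod, ← Finset.sum_div, div_div,
    Nat.cast_mul, mul_comm]

lemma avg_comm (f : X → Y → ℝ) :
    (avg fun x => avg fun y => f x y) = avg fun y => avg fun x => f x y := by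
  rw [← avg_prod (fun p : X × Y => f p.1 p.2), ← avg_prod (fun p : Y × X => f p.2 p.1),
    ← avg_equiv (Equiv.prodComm X Y)]
  rfl

lemma avg_unique [Unique X] (f : X → ℝ) : avg f = f default := by
  have := Fintype.ofFinite X
  simp [avg_eq]

variable {I J A : Type*} [Finite I] [Finite J] [Finite A]

lemma avg_sumElim (f : (I ⊕ J → A) → ℝ) :
    avg f = avg fun x : I → A => avg fun y : J → A => f (Sum.elim x y) := by
  rw [← avg_equiv (Equiv.sumArrowEquivProdArrow I J A).symm, avg_prod]
  rfl

lemma avg_optionElim (f : (Option I → A) → ℝ) :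
    avg f = avg fun a : A => avg fun x : I → A => f (fun o => o.elim a x) := by
  rw [← avg_equiv (Equiv.piOptionEquivProd (β := fun _ : Option I => A)).symm, avg_prod]
  congr! 5 with a x
  funext o
  cases o <;> rfl

end avg

open Classical in
/-- The indicator function of a set. -/
noncomputable def ind {X : Type*} (A : Set X) (x : X) : ℝ := if x ∈ A then 1 else 0

section ind

variable {X : Type*} {A : Set X} {x : X}

lemma ind_of_mem (h : x ∈ A) : ind A x = 1 := if_pos h

lemma ind_of_notMem (h : x ∉ A) : ind A x = 0 := if_neg h

lemma ind_nonneg (A : Set X) (x : X) : 0 ≤ ind A x := by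
  rw [ind]; split_ifs <;> norm_num

lemma ind_le_one (A : Set X) (x : X) : ind A x ≤ 1 := by
  rw [ind]; split_ifs <;> norm_num

lemma exists_mem_of_avg_ind_pos (h : 0 < avg (ind A)) : ∃ x, x ∈ A := by
  by_contra! h'
  have : ind A = fun _ => 0 := funext fun x => ind_of_notMem (h' x)
  simp [this, avg] at h

end ind

/-- Substitute values `φ (x e)` for the variables `e` of a template `W`. -/
def subst {M S N B : Type*} (W : M → S ⊕ N) (φ : B → S) (x : N → B) : M → S :=
  fun i => Sum.elim id (φ ∘ x) (W i)

/-- A template is proper if every variable occurs in it. -/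
def Proper {M S N : Type*} (W : M → S ⊕ N) : Prop := ∀ e, ∃ i, W i = inr e

lemma subst_injective {M S N B : Type*} {W : M → S ⊕ N} (hW : Proper W) {φ : B → S}
    (hφ : φ.Injective) : (subst W φ).Injective := by
  intro x y h
  funext e
  obtain ⟨i, hi⟩ := hW e
  have := congrFun h i
  simp only [subst, hi, Sum.elim_inr, Function.comp] at this
  exact hφ this

section freeCoordinates

variable (S B : Type) [Finite S] [Finite B] [Nonempty S] [Nonempty B]

lemma avg_le_of_one_variable (n : ℕ) :
    ∃ (M : Type) (_ : Finite M), ∀ φ : B → S, φ.Injective → ∀ f : (M → S) → ℝ, (∀ x, f x ≤ 1) →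
      ∀ t : ℝ, 0 ≤ t →
      (∀ W : M → S ⊕ Unit, Proper W → avg (fun b => f (subst W φ fun _ => b)) ≤ t) →
      avg f ≤ t + (1 - (Nat.card B : ℝ) / Nat.card S) ^ n := by
  classical
  have := Fintype.ofFinite S
  have := Fintype.ofFinite B
  have hB : 0 < Fintype.card B := Fintype.card_pos
  have hS : 0 < Fintype.card S := Fintype.card_pos
  have hS' : (0 : ℝ) < Fintype.card S := by exact_mod_cast hS
  rw [Nat.card_eq_fintype_card, Nat.card_eq_fintype_card]
  set r := 1 - (Fintype.card B : ℝ) / Fintype.card S with hr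
  induction n with
  | zero =>
    refine ⟨Empty, inferInstance, fun φ hφ f hf t ht _ => ?_⟩
    have := avg_le hf
    simp; linarith
  | succ n ih =>
    obtain ⟨M, _, hM⟩ := ih
    refine ⟨Unit ⊕ M, inferInstance, fun φ hφ f hf t ht h => ?_⟩
    have hBS : Fintype.card B ≤ Fintype.card S := Fintype.card_le_of_injective φ hφ
    set G : S → ℝ := fun σ => avg fun v : M → S => f (Sum.elim (fun _ => σ) v) with hG
    have h1 : avg f = avg G := by
      rw [avg_sumElim, ← avg_equiv (Equiv.funUnique Unit S).symm]
      rfl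
    have h2 : avg (fun b => G (φ b)) ≤ t := by
      rw [avg_comm]
      refine avg_le fun v => ?_
      convert h (Sum.elim (fun _ => inr ()) (fun i => inl (v i))) (fun e => ⟨inl (), rfl⟩)
        using 4 with b
      funext i
      cases i <;> rfl
    have h3 : ∀ σ, G σ ≤ t + r ^ n := by
      intro σ
      refine hM φ hφ _ (fun v => hf _) t ht fun W hW => ?_
      convert h (Sum.elim (fun _ => inl σ) W) ?_ using 4 with b
      · funext i
        cases i <;> rfl
      · intro e
        obtain ⟨i, hi⟩ := hW e
        exact ⟨inr i, hi⟩
    rw [h1, avg_eq, div_le_iff₀ hS']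
    rw [avg_eq, div_le_iff₀ (by exact_mod_cast hB)] at h2
    have h4 : ∑ σ, G σ = ∑ b, G (φ b) + ∑ σ ∈ (Finset.univ.image φ)ᶜ, G σ := by
      rw [← Finset.sum_image (f := G) (g := φ) (s := Finset.univ) (fun a _ b _ h => hφ h),
        Finset.sum_add_sum_compl]
    have h5 : ∑ σ ∈ (Finset.univ.image φ)ᶜ, G σ
        ≤ ((Fintype.card S : ℝ) - Fintype.card B) * (t + r ^ n) := by
      refine (Finset.sum_le_card_nsmul _ _ _ fun σ _ => h3 σ).trans_eq ?_
      rw [Finset.card_compl, Finset.card_image_of_injective _ hφ, Finset.card_univ, nsmul_eq_mul,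
        Nat.cast_sub hBS]
    have h6 : ((Fintype.card S : ℝ) - Fintype.card B) = r * Fintype.card S := by
      rw [hr]; field_simp
    rw [h6] at h5
    rw [h4, pow_succ]
    have h7 : t * Fintype.card B = t * Fintype.card S - t * (r * Fintype.card S) := by
      rw [← h6]; ring
    nlinarith

lemma exists_free_coordinates (N : Type) [Finite N] :
    ∀ ε : ℝ, 0 < ε → ∃ (M : Type) (_ : Finite M), ∀ φ : B → S, φ.Injective →
      ∀ f : (M → S) → ℝ, (∀ x, f x ≤ 1) → ∀ t : ℝ, 0 ≤ t →
      (∀ W : M → S ⊕ N, Proper W → avg (fun x => f (subst W φ x)) ≤ t) →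
      avg f ≤ t + ε := by
  induction N using Finite.induction_empty_option with
  | of_equiv e ih =>
    intro ε hε
    obtain ⟨M, _, hM⟩ := ih ε hε
    refine ⟨M, inferInstance, fun φ hφ f hf t ht h => hM φ hφ f hf t ht fun W hW => ?_⟩
    rw [← avg_equiv (e.arrowCongr (Equiv.refl B)).symm]
    convert h (fun i => (W i).map id e) ?_ using 4 with x
    · funext i
      simp only [subst]
      cases W i <;> simp
    · intro y
      obtain ⟨i, hi⟩ := hW (e.symm y)
      exact ⟨i, by simp [hi]⟩
  | h_empty =>
    intro ε hε
    refine ⟨Empty, inferInstance, fun φ hφ f hf t ht h => ?_⟩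
    have := h (fun i => i.elim) (fun e => e.elim)
    rw [avg_unique] at this ⊢
    exact (congrArg f (Subsingleton.elim _ _)).le.trans (this.trans (by linarith))
  | h_option ih =>
    rename_i N _
    intro ε hε
    obtain ⟨M₁, _, hM₁⟩ := ih (ε / 2) (by positivity)
    have hr : ∃ n : ℕ, (1 - (Nat.card B : ℝ) / Nat.card S) ^ n < ε / 2 := by
      have hB : 0 < Nat.card B := Nat.card_pos
      have hS : 0 < Nat.card S := Nat.card_pos
      have hB' : (0 : ℝ) < Nat.card B := by exact_mod_cast hB
      have hS' : (0 : ℝ) < Nat.card S := by exact_mod_cast hS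
      have : 0 < (Nat.card B : ℝ) / Nat.card S := by positivity
      exact exists_pow_lt_of_lt_one (by positivity) (by linarith)
    obtain ⟨n, hn⟩ := hr
    obtain ⟨M₂, _, hM₂⟩ := avg_le_of_one_variable S B n
    refine ⟨M₁ ⊕ M₂, inferInstance, fun φ hφ f hf t ht h => ?_⟩
    rw [avg_sumElim]
    have key := hM₁ φ hφ (fun u => avg fun v => f (Sum.elim u v)) (fun u => avg_le fun v => hf _)
      (t + ε / 2) (by positivity) ?_
    · linarith
    intro W₁ hW₁
    rw [avg_comm]
    have := hM₂ φ hφ (fun v => avg fun x : N → B => f (Sum.elim (subst W₁ φ x) v))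
      (fun v => avg_le fun x => hf _) t ht ?_
    · linarith
    intro W₂ hW₂
    convert h (Sum.elim (fun i => (W₁ i).map id some) (fun i => (W₂ i).map id fun _ => none)) ?_
    · rw [avg_optionElim]
      congr! 6 with b x
      funext i
      cases i with
      | inl i => simp only [subst, Sum.elim_inl]; cases W₁ i <;> rfl
      | inr i => simp only [subst, Sum.elim_inr]; cases W₂ i <;> rfl
    · intro e
      cases e with
      | none =>
        obtain ⟨i, hi⟩ := hW₂ ()
        exact ⟨inr i, by simp [hi]⟩
      | some e =>
        obtain ⟨i, hi⟩ := hW₁ e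
        exact ⟨inl i, by simp [hi]⟩

end freeCoordinates

/-- A set of words contains a combinatorial line. -/
def ContainsLine {α M : Type} (A : Set (M → α)) : Prop :=
  ∃ u : M → Option α, (∃ i, u i = none) ∧ ∀ a, (fun i => (u i).getD a) ∈ A

lemma ContainsLine.of_preimage_subst {α M N : Type} {A : Set (M → α)} {W : M → α ⊕ N}
    (hW : Proper W) (h : ContainsLine {x | subst W id x ∈ A}) : ContainsLine A := by
  obtain ⟨u, ⟨j, hj⟩, hu⟩ := h
  obtain ⟨i, hi⟩ := hW j
  refine ⟨fun i => (W i).elim some u, ⟨i, by simp [hi, hj]⟩, fun a => ?_⟩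
  have h' : subst W id (fun j => (u j).getD a) ∈ A := hu a
  convert h' using 1
  funext i
  simp only [subst]
  cases W i <;> rfl

/-- Density Hales–Jewett at density `δ`: in some dimension, every set of words of density at
least `δ` contains a combinatorial line. -/
def HasLine (α : Type) (δ : ℝ) : Prop :=
  ∃ (M : Type) (_ : Finite M), ∀ A : Set (M → α), δ ≤ avg (ind A) → ContainsLine A

lemma HasLine.exists_subspace {α : Type} [Finite α] [Nonempty α] (h : ∀ δ, 0 < δ → HasLine α δ)
    (N : Type) [Finite N] : ∀ δ : ℝ, 0 < δ → ∃ (M : Type) (_ : Finite M), ∀ A : Set (M → α),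
      δ ≤ avg (ind A) → ∃ W : M → α ⊕ N, Proper W ∧ ∀ x, subst W id x ∈ A := by
  induction N using Finite.induction_empty_option with
  | of_equiv e ih =>
    intro δ hδ
    obtain ⟨M, _, hM⟩ := ih δ hδ
    refine ⟨M, inferInstance, fun A hA => ?_⟩
    obtain ⟨W, hW, hWA⟩ := hM A hA
    refine ⟨fun i => (W i).map id e, fun y => ?_, fun x => ?_⟩
    · obtain ⟨i, hi⟩ := hW (e.symm y)
      exact ⟨i, by simp [hi]⟩
    · convert hWA (x ∘ e) using 1
      funext i
      simp only [subst]
      cases W i <;> simp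
  | h_empty =>
    intro δ hδ
    refine ⟨Empty, inferInstance, fun A hA => ?_⟩
    obtain ⟨x, hx⟩ := exists_mem_of_avg_ind_pos (hδ.trans_le hA)
    refine ⟨fun i => i.elim, fun e => e.elim, fun y => ?_⟩
    rwa [Subsingleton.elim (subst _ _ _) x]
  | h_option ih =>
    rename_i N _
    intro δ hδ
    obtain ⟨M₁, _, hM₁⟩ := ih (δ / 2) (by positivity)
    have : Finite {W : M₁ → α ⊕ N // Proper W} := inferInstance
    have := Fintype.ofFinite {W : M₁ → α ⊕ N // Proper W}
    set c : ℝ := ((Fintype.card {W : M₁ → α ⊕ N // Proper W} : ℕ) : ℝ) with hc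
    have hc0 : 0 ≤ c := Nat.cast_nonneg _
    obtain ⟨M₂, _, hM₂⟩ := h (δ / 2 / (c + 1)) (by positivity)
    refine ⟨M₁ ⊕ M₂, inferInstance, fun A hA => ?_⟩
    have key : ∃ W : {W : M₁ → α ⊕ N // Proper W}, δ / 2 / (c + 1) ≤
        avg (ind {y : M₂ → α | ∀ x, Sum.elim (subst W.1 id x) y ∈ A}) := by
      by_contra! hW
      rw [avg_sumElim, avg_comm] at hA
      have h1 : avg (fun y : M₂ → α => avg fun x : M₁ → α => ind A (Sum.elim x y)) ≤
          avg (fun y : M₂ → α => δ / 2 + ∑ W : {W : M₁ → α ⊕ N // Proper W},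
            ind {y : M₂ → α | ∀ x, Sum.elim (subst W.1 id x) y ∈ A} y) := by
        refine avg_mono fun y => ?_
        by_cases hy : δ / 2 ≤ avg fun x : M₁ → α => ind A (Sum.elim x y)
        · obtain ⟨W, hW, hWA⟩ := hM₁ {x | Sum.elim x y ∈ A} hy
          have h2 : (1 : ℝ) ≤ ∑ W : {W : M₁ → α ⊕ N // Proper W},
              ind {y : M₂ → α | ∀ x, Sum.elim (subst W.1 id x) y ∈ A} y := by
            have := Finset.single_le_sum (f := fun W : {W : M₁ → α ⊕ N // Proper W} =>
              ind {y : M₂ → α | ∀ x, Sum.elim (subst W.1 id x) y ∈ A} y)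
              (fun W _ => ind_nonneg _ _) (Finset.mem_univ ⟨W, hW⟩)
            refine le_trans ?_ this
            rw [ind_of_mem]
            exact hWA
          have h3 : avg (fun x : M₁ → α => ind A (Sum.elim x y)) ≤ 1 :=
            avg_le fun x => ind_le_one _ _
          linarith
        · have : 0 ≤ ∑ W : {W : M₁ → α ⊕ N // Proper W},
            ind {y : M₂ → α | ∀ x, Sum.elim (subst W.1 id x) y ∈ A} y :=
            Finset.sum_nonneg fun W _ => ind_nonneg _ _
          linarith
      rw [avg_add, avg_const, avg_sum] at h1
      have h2 := Finset.sum_le_card_nsmul Finset.univ (fun W : {W : M₁ → α ⊕ N // Proper W} =>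
        avg (ind {y : M₂ → α | ∀ x, Sum.elim (subst W.1 id x) y ∈ A})) _ (fun W _ => (hW W).le)
      rw [Finset.card_univ, nsmul_eq_mul, ← hc] at h2
      have h3 : c * (δ / 2 / (c + 1)) < δ / 2 := by
        rw [mul_div_assoc', div_lt_iff₀ (by positivity)]
        nlinarith
      exact absurd (hA.trans h1) (by linarith)
    obtain ⟨⟨W, hW⟩, hWA⟩ := key
    obtain ⟨u, ⟨i, hi⟩, hu⟩ := hM₂ _ hWA
    refine ⟨Sum.elim (fun i => (W i).map id some) (fun i => (u i).elim (inr none) inl),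
      fun e => ?_, fun x => ?_⟩
    · cases e with
      | none => exact ⟨inr i, by simp [hi]⟩
      | some e =>
        obtain ⟨j, hj⟩ := hW e
        exact ⟨inl j, by simp [hj]⟩
    · convert hu (x none) (fun e => x (some e)) using 1
      funext i
      cases i with
      | inl i => simp only [subst, Sum.elim_inl]; cases W i <;> rfl
      | inr i => simp only [subst, Sum.elim_inr]; cases u i <;> rfl

/-- A set of words over `Option α` is insensitive at `a` if membership does not change when
letters `none` and `some a` are interchanged. -/
def Insensitive {α M : Type} (a : α) (D : Set (M → Option α)) : Prop :=
  ∀ x y : M → Option α, (∀ i, (x i).getD a = (y i).getD a) → x ∈ D → y ∈ D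

lemma Insensitive.preimage_subst {α M N : Type} {a : α} {D : Set (M → Option α)}
    (hD : Insensitive a D) (W : M → Option α ⊕ N) :
    Insensitive a {x | subst W id x ∈ D} := by
  intro x y hxy hx
  refine hD _ _ (fun i => ?_) hx
  simp only [subst]
  cases W i with
  | inl s => rfl
  | inr e => exact hxy e

lemma Insensitive.compl {M : Type} {a : α} {D : Set (M → Option α)} (hD : Insensitive a D) :
    Insensitive a Dᶜ :=
  fun x y hxy hx hy => hx (hD y x (fun i => (hxy i).symm) hy)

lemma HasLine.exists_subspace_of_insensitive {α : Type} [Finite α] [Nonempty α]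
    (h : ∀ δ, 0 < δ → HasLine α δ) (N : Type) [Finite N] (a : α) {δ : ℝ} (hδ : 0 < δ) :
    ∃ (M : Type) (_ : Finite M), ∀ D : Set (M → Option α), Insensitive a D →
      δ ≤ avg (ind D) → ∃ W : M → Option α ⊕ N, Proper W ∧ ∀ x, subst W id x ∈ D := by
  obtain ⟨M₁, _, hM₁⟩ := HasLine.exists_subspace h N (δ / 2) (by positivity)
  obtain ⟨M, _, hM⟩ := exists_free_coordinates (Option α) α M₁ (δ / 4) (by positivity)
  refine ⟨M, inferInstance, fun D hD hDδ => ?_⟩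
  have key : ∃ W : M → Option α ⊕ M₁, Proper W ∧
      δ / 2 ≤ avg (fun x : M₁ → α => ind D (subst W some x)) := by
    by_contra! hW
    have := hM _ (Option.some_injective α) (ind D) (ind_le_one D) (δ / 2) (by positivity)
      fun W hW' => (hW W hW').le
    linarith
  obtain ⟨W, hW, hWD⟩ := key
  obtain ⟨V, hV, hVD⟩ := hM₁ {x | subst W some x ∈ D} hWD
  refine ⟨fun i => (W i).elim inl fun j => (V j).map some id, fun e => ?_, fun x => ?_⟩
  · obtain ⟨j, hj⟩ := hV e
    obtain ⟨i, hi⟩ := hW j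
    exact ⟨i, by simp [hi, hj]⟩
  · refine hD _ _ (fun i => ?_) (hVD fun e => (x e).getD a)
    simp only [subst]
    cases W i with
    | inl s => rfl
    | inr j =>
      simp only [Function.comp, Sum.elim_inr, subst]
      cases V j <;> simp

lemma avg_ind_range_mul {X Y : Type*} [Finite X] [Finite Y] [Nonempty X] {g : X → Y}
    (hg : g.Injective) (h : Y → ℝ) :
    avg (fun y => ind (Set.range g) y * h y) =
      (Nat.card X : ℝ) / Nat.card Y * avg fun x => h (g x) := by
  classical
  have := Fintype.ofFinite X
  have := Fintype.ofFinite Y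
  have hX : (0 : ℝ) < Fintype.card X := by exact_mod_cast Fintype.card_pos
  have h1 : ∑ y, ind (Set.range g) y * h y = ∑ x, h (g x) := by
    rw [← Finset.sum_image (f := h) (g := g) (s := Finset.univ) (fun a _ b _ h => hg h),
      ← Finset.sum_subset (Finset.subset_univ (Finset.univ.image g))]
    · refine Finset.sum_congr rfl fun y hy => ?_
      rw [ind_of_mem (by simpa using hy), one_mul]
    · intro y _ hy
      rw [ind_of_notMem (by simpa using hy), zero_mul]
  rw [avg_eq, avg_eq, h1, Nat.card_eq_fintype_card, Nat.card_eq_fintype_card]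
  field_simp

section insensitive

variable {α : Type} [Finite α]

lemma exists_structured_subset {M N : Type} [Finite M] [Finite N] (s : Set (M → Option α)) :
    ∃ R ⊆ s, (∀ (h : (M → Option α) → ℝ) (t : ℝ), 0 ≤ t →
      (∀ W : M → Option α ⊕ N, Proper W → avg (fun x => h (subst W id x)) ≤ t) →
      avg (fun y => ind R y * h y) ≤ t * avg (ind R)) ∧
      ((∃ W : M → Option α ⊕ N, Proper W ∧ ∀ x, subst W id x ∈ s) →
        1 ≤ (Nat.card (M → Option α) : ℝ) * avg (ind R)) := by
  by_cases hs : ∃ W : M → Option α ⊕ N, Proper W ∧ ∀ x, subst W id x ∈ s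
  · obtain ⟨W, hW, hWs⟩ := hs
    have hinj : (subst W (id : Option α → Option α)).Injective :=
      subst_injective hW Function.injective_id
    have h1 := avg_ind_range_mul hinj
    have hX : (1 : ℝ) ≤ Nat.card (N → Option α) := by
      exact_mod_cast Nat.card_pos (α := N → Option α)
    have hY : (0 : ℝ) < Nat.card (M → Option α) := by
      exact_mod_cast Nat.card_pos (α := M → Option α)
    have h2 : avg (ind (Set.range (subst W (id : Option α → Option α)))) =
        (Nat.card (N → Option α) : ℝ) / Nat.card (M → Option α) := by
      simpa using h1 fun _ => 1
    refine ⟨Set.range (subst W id), Set.range_subset_iff.2 hWs, fun h t ht hWt => ?_, fun _ => ?_⟩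
    · rw [h1, h2, mul_comm t]
      exact mul_le_mul_of_nonneg_left (hWt W hW) (by positivity)
    · rw [h2]
      field_simp
      exact hX
  · refine ⟨∅, Set.empty_subset _, fun h t ht hWt => ?_, fun h => absurd h hs⟩
    have : ind (∅ : Set (M → Option α)) = fun _ => 0 := funext fun y => ind_of_notMem (by simp)
    simp [this]

lemma avg_ind_mul_le_of_rounds {M₀ N : Type} [Finite M₀] [Finite N] (a : α) {ε : ℝ} (hε : 0 < ε)
    (hM₀ : ∀ D : Set (M₀ → Option α), Insensitive a D → ε / 2 ≤ avg (ind D) →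
      ∃ W : M₀ → Option α ⊕ N, Proper W ∧ ∀ x, subst W id x ∈ D) (T : ℕ) :
    ∃ (M : Type) (_ : Finite M), ∀ (Z : Type) [Finite Z] [Nonempty Z]
      (h : Z → (M → Option α) → ℝ), (∀ z x, h z x ≤ 1) → ∀ t : ℝ, 0 ≤ t →
      (∀ z, ∀ W : M → Option α ⊕ N, Proper W → avg (fun x => h z (subst W id x)) ≤ t) →
      ∀ D : Z → Set (M → Option α), (∀ z, Insensitive a (D z)) →
      avg (fun z => avg fun y => ind (D z) y * h z y) ≤
        t * avg (fun z => avg (ind (D z))) +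
          max ε (avg (fun z => avg (ind (D z))) -
            ε / 2 / Nat.card (M₀ → Option α) * T) := by
  have hcard : (0 : ℝ) < Nat.card (M₀ → Option α) := by
    exact_mod_cast Nat.card_pos (α := M₀ → Option α)
  set C : ℝ := ((Nat.card (M₀ → Option α) : ℕ) : ℝ) with hC
  have triv : ∀ {M Z : Type} [Finite M] [Finite Z] [Nonempty Z]
      (h : Z → (M → Option α) → ℝ), (∀ z x, h z x ≤ 1) → ∀ D : Z → Set (M → Option α),
      avg (fun z => avg fun y => ind (D z) y * h z y) ≤ avg (fun z => avg (ind (D z))) :=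
    fun h h1 D => avg_mono fun z => avg_mono fun y =>
      mul_le_of_le_one_right (ind_nonneg _ _) (h1 z y)
  have nonneg : ∀ {M Z : Type} [Finite M] [Finite Z] [Nonempty Z]
      (D : Z → Set (M → Option α)), 0 ≤ avg (fun z => avg (ind (D z))) :=
    fun D => avg_nonneg fun z => avg_nonneg fun y => ind_nonneg _ _
  induction T with
  | zero =>
    refine ⟨Empty, inferInstance, fun Z _ _ h h1 t ht _ D _ => ?_⟩
    have h2 := triv h h1 D
    have h3 := mul_nonneg ht (nonneg D)
    refine h2.trans (le_trans ?_ (le_add_of_nonneg_left h3))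
    simp
  | succ T ih =>
    obtain ⟨M, _, hM⟩ := ih
    refine ⟨M₀ ⊕ M, inferInstance, fun Z _ _ h h1 t ht hW D hD => ?_⟩
    set μ := avg (fun z => avg (ind (D z))) with hμ
    have h3 := mul_nonneg ht (nonneg D)
    by_cases hμε : μ ≤ ε
    · refine (triv h h1 D).trans ?_
      exact hμε.trans ((le_max_left _ _).trans (le_add_of_nonneg_left h3))
    push Not at hμε
    choose R hRs hRavg hRcard using
      fun s : Set (M₀ → Option α) => exists_structured_subset (N := N) s
    let sl : Z → (M → Option α) → Set (M₀ → Option α) := fun z v => {u | Sum.elim u v ∈ D z}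
    let D' : Z × (M₀ → Option α) → Set (M → Option α) :=
      fun p => {v | p.2 ∈ sl p.1 v ∧ p.2 ∉ R (sl p.1 v)}
    let h' : Z × (M₀ → Option α) → (M → Option α) → ℝ := fun p v => h p.1 (Sum.elim p.2 v)
    have hsl : ∀ z v v', (∀ i, (v i).getD a = (v' i).getD a) → sl z v = sl z v' := by
      intro z v v' hv
      ext u
      constructor <;> refine hD z _ _ fun i => ?_
      · cases i with
        | inl i => rfl
        | inr i => exact hv i
      · cases i with
        | inl i => rfl
        | inr i => exact (hv i).symm
    have hD' : ∀ p, Insensitive a (D' p) := by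
      intro p v v' hv hvD
      change p.2 ∈ sl p.1 v' ∧ p.2 ∉ R (sl p.1 v')
      rwa [← hsl p.1 v v' hv]
    have hsplit : ∀ z u v, ind (D z) (Sum.elim u v) =
        ind (R (sl z v)) u + ind (D' (z, u)) v := by
      intro z u v
      change ind (sl z v) u = _
      by_cases hu : u ∈ sl z v
      · by_cases hu' : u ∈ R (sl z v)
        · rw [ind_of_mem hu, ind_of_mem hu',
            ind_of_notMem (A := D' (z, u)) fun h => h.2 hu', add_zero]
        · rw [ind_of_mem hu, ind_of_notMem hu', ind_of_mem (A := D' (z, u)) ⟨hu, hu'⟩, zero_add]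
      · rw [ind_of_notMem hu, ind_of_notMem fun h => hu (hRs _ h),
          ind_of_notMem (A := D' (z, u)) fun h => hu h.1,
          zero_add]
    set r := avg fun z => avg fun v => avg (ind (R (sl z v))) with hr
    set μ' := avg fun p => avg (ind (D' p)) with hμ'
    have hμr : μ = r + μ' := by
      rw [hμ, hr, hμ', avg_prod, ← avg_add]
      congr! 2 with z
      rw [avg_sumElim, avg_comm (fun v u => ind (R (sl z v)) u), ← avg_add]
      congr! 2 with u
      rw [← avg_add]
      congr! 2 with v
      exact hsplit z u v
    have hrc : ε / 2 / C ≤ r := by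
      have h4 : μ ≤ ε / 2 + C * r := by
        have h5 : μ = avg fun z => avg fun v => avg (ind (sl z v)) := by
          rw [hμ]
          congr! 2 with z
          rw [avg_sumElim, avg_comm]
          rfl
        have h6 : ε / 2 + C * r =
            avg fun z => avg fun v => ε / 2 + C * avg (ind (R (sl z v))) := by
          simp only [avg_add, avg_const, avg_const_mul, hr]
        rw [h5, h6]
        refine avg_mono fun z => avg_mono fun v => ?_
        by_cases hs : ε / 2 ≤ avg (ind (sl z v))
        · have h7 : Insensitive a (sl z v) := by
            intro u u' hu huD
            refine hD z _ _ (fun i => ?_) huD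
            cases i with
            | inl i => exact hu i
            | inr i => rfl
          have h8 := hRcard _ (hM₀ _ h7 hs)
          have h9 : avg (ind (sl z v)) ≤ 1 := avg_le (ind_le_one _)
          linarith
        · have : 0 ≤ C * avg (ind (R (sl z v))) := mul_nonneg hcard.le (avg_nonneg (ind_nonneg _))
          linarith
      rw [div_le_iff₀ hcard]
      linarith
    have hmain : (avg fun z => avg fun y => ind (D z) y * h z y) =
        (avg fun z => avg fun v => avg fun u => ind (R (sl z v)) u * h z (Sum.elim u v)) +
          avg fun p => avg fun v => ind (D' p) v * h' p v := by
      rw [avg_prod, ← avg_add]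
      congr! 2 with z
      rw [avg_sumElim, avg_comm (fun v u => ind (R (sl z v)) u * h z (Sum.elim u v)), ← avg_add]
      congr! 2 with u
      rw [← avg_add]
      congr! 2 with v
      rw [hsplit z u v, add_mul]
    have hfst : (avg fun z => avg fun v => avg fun u =>
        ind (R (sl z v)) u * h z (Sum.elim u v)) ≤ t * r := by
      rw [hr, ← avg_const_mul]
      refine avg_mono fun z => ?_
      rw [← avg_const_mul]
      refine avg_mono fun v => ?_
      refine hRavg _ _ t ht fun W hWp => ?_
      convert hW z (Sum.elim W (fun i => inl (v i))) ?_ using 4 with x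
      · funext i
        cases i <;> rfl
      · intro e
        obtain ⟨i, hi⟩ := hWp e
        exact ⟨inl i, hi⟩
    have hsnd := hM (Z × (M₀ → Option α)) h' (fun p v => h1 _ _) t ht (fun p W hWp => by
      convert hW p.1 (Sum.elim (fun i => inl (p.2 i)) W) ?_ using 4 with x
      · funext i
        cases i <;> rfl
      · intro e
        obtain ⟨i, hi⟩ := hWp e
        exact ⟨inr i, hi⟩) D' hD'
    rw [← hμ'] at hsnd
    have hle : max ε (μ' - ε / 2 / C * T) ≤ max ε (μ - ε / 2 / C * (T + 1 : ℕ)) := by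
      push_cast
      refine max_le_max le_rfl ?_
      linarith
    have htμ : t * μ = t * r + t * μ' := by rw [hμr]; ring
    rw [hmain, htμ]
    linarith

end insensitive

section intersections

variable {α : Type} [Finite α] [Nonempty α]

lemma HasLine.avg_ind_mul_le (h : ∀ δ, 0 < δ → HasLine α δ) (N : Type) [Finite N] (a : α)
    {ε : ℝ} (hε : 0 < ε) :
    ∃ (M : Type) (_ : Finite M), ∀ g : (M → Option α) → ℝ, (∀ x, g x ≤ 1) →
      (∀ W : M → Option α ⊕ N, Proper W → avg (fun x => g (subst W id x)) ≤ ε) →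
      ∀ D : Set (M → Option α), Insensitive a D → avg (fun x => ind D x * g x) ≤ 2 * ε := by
  obtain ⟨M₀, _, hM₀⟩ := HasLine.exists_subspace_of_insensitive h N a (half_pos hε)
  have hcard : (0 : ℝ) < Nat.card (M₀ → Option α) := by
    exact_mod_cast Nat.card_pos (α := M₀ → Option α)
  have hc : 0 < ε / 2 / Nat.card (M₀ → Option α) := by positivity
  obtain ⟨T, hT⟩ := exists_nat_ge (1 / (ε / 2 / Nat.card (M₀ → Option α)))
  rw [div_le_iff₀ hc] at hT
  obtain ⟨M, _, hM⟩ := avg_ind_mul_le_of_rounds a hε hM₀ T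
  refine ⟨M, inferInstance, fun g hg hW D hD => ?_⟩
  have key := hM Unit (fun _ => g) (fun _ => hg) ε hε.le (fun _ => hW) (fun _ => D) fun _ => hD
  simp only [avg_const] at key
  have h1 : avg (ind D) ≤ 1 := avg_le (ind_le_one D)
  have h2 : max ε (avg (ind D) - ε / 2 / Nat.card (M₀ → Option α) * T) ≤ ε :=
    max_le le_rfl (by linarith)
  nlinarith

lemma HasLine.avg_prod_ind_mul_le (h : ∀ δ, 0 < δ → HasLine α δ) (N : Type) [Finite N]
    (s : Finset α) : ∀ {ε : ℝ}, 0 < ε →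
    ∃ (M : Type) (_ : Finite M), ∀ g : (M → Option α) → ℝ, (∀ x, g x ≤ 1) →
      (∀ W : M → Option α ⊕ N, Proper W → avg (fun x => g (subst W id x)) ≤ 0) →
      ∀ P : α → Set (M → Option α), (∀ a, Insensitive a (P a)) →
      avg (fun x => (∏ a ∈ s, ind (P a) x) * g x) ≤ ε := by
  classical
  induction s using Finset.induction_on with
  | empty =>
    intro ε hε
    refine ⟨N, inferInstance, fun g _ hW P _ => ?_⟩
    simp only [Finset.prod_empty, one_mul]
    exact (hW inr fun e => ⟨e, rfl⟩).trans hε.le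
  | insert a s ha ih =>
    intro ε hε
    obtain ⟨M₁, _, hM₁⟩ := ih (half_pos hε)
    obtain ⟨M, _, hM⟩ := HasLine.avg_ind_mul_le h M₁ a (half_pos hε)
    refine ⟨M, inferInstance, fun g hg hW P hP => ?_⟩
    have key := hM (fun x => (∏ a ∈ s, ind (P a) x) * g x) (fun x => ?_) (fun V hV => ?_)
      (P a) (hP a)
    · simp only [Finset.prod_insert ha, mul_assoc]
      linarith
    · have h0 : 0 ≤ ∏ a ∈ s, ind (P a) x := Finset.prod_nonneg fun a _ => ind_nonneg _ _
      have h1 : ∏ a ∈ s, ind (P a) x ≤ 1 :=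
        Finset.prod_le_one (fun a _ => ind_nonneg _ _) fun a _ => ind_le_one _ _
      nlinarith [hg x]
    · refine hM₁ (fun x => g (subst V id x)) (fun x => hg _) (fun W hW' => ?_)
        (fun a => {x | subst V id x ∈ P a}) fun a => (hP a).preimage_subst V
      convert hW (fun i => (V i).elim inl W) ?_ using 4 with x
      · funext i
        simp only [subst]
        cases V i <;> rfl
      · intro e
        obtain ⟨j, hj⟩ := hW' e
        obtain ⟨i, hi⟩ := hV j
        exact ⟨i, by simp [hi, hj]⟩

lemma HasLine.avg_one_sub_prod_ind_mul_le [Fintype α] (h : ∀ δ, 0 < δ → HasLine α δ)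
    (N : Type) [Finite N] {ε : ℝ} (hε : 0 < ε) :
    ∃ (M : Type) (_ : Finite M), ∀ g : (M → Option α) → ℝ, (∀ x, g x ≤ 1) →
      (∀ W : M → Option α ⊕ N, Proper W → avg (fun x => g (subst W id x)) ≤ 0) →
      ∀ P : α → Set (M → Option α), (∀ a, Insensitive a (P a)) →
      avg (fun x => (1 - ∏ a, ind (P a) x) * g x) ≤ ε := by
  classical
  have hα : (0 : ℝ) < Fintype.card α := by exact_mod_cast Fintype.card_pos
  obtain ⟨M, _, hM⟩ := HasLine.avg_prod_ind_mul_le h N Finset.univ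
    (ε := ε / Fintype.card α) (by positivity)
  refine ⟨M, inferInstance, fun g hg hW P hP => ?_⟩
  have key : ∀ s : Finset α, avg (fun x => (1 - ∏ a ∈ s, ind (P a) x) * g x) ≤
      s.card * (ε / Fintype.card α) := by
    intro s
    induction s using Finset.induction_on with
    | empty => simp
    | insert a s ha ih =>
      let Q : α → Set (M → Option α) :=
        fun b => if b ∈ s then P b else if b = a then (P b)ᶜ else Set.univ
      have hQ : ∀ b, Insensitive b (Q b) := by
        intro b
        simp only [Q]
        split_ifs
        · exact hP b
        · exact (hP b).compl
        · exact fun _ _ _ _ => trivial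
      have h1 := hM g hg hW Q hQ
      have h2 : ∀ x, ∏ b, ind (Q b) x = (1 - ind (P a) x) * ∏ b ∈ s, ind (P b) x := by
        intro x
        rw [← Finset.prod_subset (Finset.subset_univ (insert a s)), Finset.prod_insert ha]
        · congr 1
          · simp only [Q, if_neg ha, if_true]
            by_cases hx : x ∈ P a
            · rw [ind_of_mem hx, ind_of_notMem (not_not.2 hx), sub_self]
            · rw [ind_of_notMem hx, ind_of_mem hx, sub_zero]
          · refine Finset.prod_congr rfl fun b hb => ?_
            simp only [Q, if_pos hb]
        · intro b _ hb
          rw [Finset.mem_insert, not_or] at hb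
          simp only [Q, if_neg hb.1, if_neg hb.2]
          exact ind_of_mem trivial
      have h3 : avg (fun x => (1 - ∏ b ∈ insert a s, ind (P b) x) * g x) =
          avg (fun x => (1 - ∏ b ∈ s, ind (P b) x) * g x) +
            avg (fun x => (∏ b, ind (Q b) x) * g x) := by
        rw [← avg_add]
        congr! 2 with x
        rw [h2, Finset.prod_insert ha]
        ring
      rw [h3, Finset.card_insert_of_notMem ha]
      push_cast
      linarith
  refine (key Finset.univ).trans_eq ?_
  rw [Finset.card_univ]
  field_simp

end intersections

section densityIncrement

lemma avg_ind_forall_ne_none (α I : Type) [Finite α] [Nonempty α] [Finite I] :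
    avg (ind {x : I → Option α | ∀ i, x i ≠ none}) =
      ((Nat.card α : ℝ) / (Nat.card α + 1)) ^ Nat.card I := by
  have hinj : (fun (x : I → α) i => some (x i)).Injective := fun x y h =>
    funext fun i => Option.some_injective _ (congrFun h i)
  have h1 := avg_ind_range_mul hinj fun _ => 1
  have h2 : Set.range (fun (x : I → α) i => some (x i)) = {x | ∀ i, x i ≠ none} := by
    ext x
    constructor
    · rintro ⟨y, rfl⟩ i
      simp
    · intro hx
      choose y hy using fun i => Option.ne_none_iff_exists'.1 (hx i)
      exact ⟨y, funext fun i => (hy i).symm⟩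
  simp only [mul_one, avg_const, h2] at h1
  rw [h1, Nat.card_fun, Nat.card_fun, Finite.card_option]
  push_cast
  rw [div_pow]

lemma le_of_le_avg {X : Type*} [Finite X] {f : X → ℝ} {c e : ℝ} (h1 : ∀ x, f x ≤ c + e)
    (h2 : c - e ≤ avg f) (x : X) : c + e - 2 * Nat.card X * e ≤ f x := by
  have := Fintype.ofFinite X
  have : Nonempty X := ⟨x⟩
  have hX : (0 : ℝ) < Fintype.card X := by exact_mod_cast Fintype.card_pos
  have h3 : c + e - f x ≤ ∑ y, (c + e - f y) :=
    Finset.single_le_sum (f := fun x => c + e - f x) (fun y _ => sub_nonneg.2 (h1 y))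
      (Finset.mem_univ x)
  rw [Finset.sum_sub_distrib, Finset.sum_const, Finset.card_univ, nsmul_eq_mul] at h3
  rw [avg_eq, le_div_iff₀ hX] at h2
  rw [Nat.card_eq_fintype_card]
  linarith

variable {α : Type}

/-- Replace the letter `none` by `some a`. -/
def fill {M : Type} (a : α) (x : M → Option α) : M → Option α := fun i => some ((x i).getD a)

lemma containsLine_of_fill_mem {M : Type} {A : Set (M → Option α)} {x : M → Option α}
    (hx : ∃ i, x i = none) (hxA : x ∈ A) (h : ∀ a, fill a x ∈ A) : ContainsLine A := by
  obtain ⟨i, hi⟩ := hx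
  refine ⟨fun i => (x i).map some, ⟨i, by simp [hi]⟩, fun a => ?_⟩
  cases a with
  | none =>
    convert hxA using 1
    funext i
    change ((x i).map some).getD none = x i
    cases x i <;> rfl
  | some a =>
    convert h a using 1
    funext i
    change ((x i).map some).getD (some a) = some ((x i).getD a)
    cases x i <;> rfl

variable [Fintype α] [Nonempty α]

lemma avg_add_mul_avg_prod_le {I T : Type} [Finite I] [Finite T] {N : Type} [Finite N]
    {δ e : ℝ} (hδ : 0 < δ) (he : 0 < e)
    (hI : ∀ g : (I → Option α) → ℝ, (∀ x, g x ≤ 1) →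
      (∀ W : I → Option α ⊕ N, Proper W → avg (fun x => g (subst W id x)) ≤ 0) →
      ∀ P : α → Set (I → Option α), (∀ a, Insensitive a (P a)) →
      avg (fun x => (1 - ∏ a, ind (P a) x) * g x) ≤ e)
    (hT : avg (ind {x : I ⊕ T → Option α | ∀ i, x i ≠ none}) ≤ e)
    (hN : ∀ A : Set (N → Option α), δ + e ≤ avg (ind A) → ContainsLine A)
    {A : Set (I ⊕ T → Option α)} (hA : ¬ ContainsLine A) {P : α → Set (I ⊕ T → Option α)}
    (hP : ∀ a, Insensitive a (P a))
    (hPA : ∀ x, (∃ i, x i = none) → x ∈ A → ∃ a, x ∉ P a) :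
    avg (ind A) + δ * avg (fun x => ∏ a, ind (P a) x) ≤ δ + 3 * e := by
  have h1 : avg (fun x => (1 - ∏ a, ind (P a) x) * (ind A x - (δ + e))) ≤ e := by
    rw [avg_sumElim, avg_comm]
    refine avg_le fun v => ?_
    refine hI (fun x => ind A (Sum.elim x v) - (δ + e)) (fun x => ?_) (fun V hV => ?_)
      (fun a => {x | Sum.elim x v ∈ P a}) fun a x y hxy hx => ?_
    · linarith [ind_le_one A (Sum.elim x v)]
    · by_contra! hpos
      rw [avg_sub, avg_const] at hpos
      apply hA
      refine ContainsLine.of_preimage_subst (W := Sum.elim V (fun i => inl (v i))) ?_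
        (hN _ ?_)
      · intro e
        obtain ⟨i, hi⟩ := hV e
        exact ⟨inl i, hi⟩
      · refine le_trans (by linarith) (avg_mono fun x => le_of_eq (congrArg (ind A) ?_)) (b :=
          avg fun x => ind A (Sum.elim (subst V id x) v))
        funext i
        cases i <;> rfl
    · refine hP a _ _ (fun i => ?_) hx
      cases i with
      | inl i => exact hxy i
      | inr i => rfl
  have h2 : avg (fun x => (∏ a, ind (P a) x) * ind A x) ≤ e := by
    refine (avg_mono fun x => ?_).trans hT
    have h0 : 0 ≤ ∏ a, ind (P a) x := Finset.prod_nonneg fun a _ => ind_nonneg _ _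
    have h1 : ∏ a, ind (P a) x ≤ 1 :=
      Finset.prod_le_one (fun a _ => ind_nonneg _ _) fun a _ => ind_le_one _ _
    by_cases hx : ∀ i, x i ≠ none
    · rw [ind_of_mem (A := {x : I ⊕ T → Option α | ∀ i, x i ≠ none}) hx]
      nlinarith [ind_le_one A x, ind_nonneg A x]
    · rw [ind_of_notMem (A := {x : I ⊕ T → Option α | ∀ i, x i ≠ none}) hx]
      push Not at hx
      by_cases hxA : x ∈ A
      · obtain ⟨a, ha⟩ := hPA x hx hxA
        rw [Finset.prod_eq_zero (Finset.mem_univ a) (ind_of_notMem (A := P a) ha), zero_mul]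
      · rw [ind_of_notMem hxA, mul_zero]
  have h3 : 0 ≤ avg (fun x => ∏ a, ind (P a) x) :=
    avg_nonneg fun x => Finset.prod_nonneg fun a _ => ind_nonneg _ _
  have h4 : avg (ind A) = avg (fun x => (1 - ∏ a, ind (P a) x) * (ind A x - (δ + e))) +
      ((δ + e) * (1 - avg (fun x => ∏ a, ind (P a) x)) +
        avg (fun x => (∏ a, ind (P a) x) * ind A x)) := by
    have h5 : 1 - avg (fun x => ∏ a, ind (P a) x) = avg fun x => 1 - ∏ a, ind (P a) x := by
      rw [avg_sub, avg_const]
    rw [h5, ← avg_const_mul, ← avg_add, ← avg_add]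
    congr! 2 with x
    ring
  nlinarith

lemma HasLine.exists_lt_of_forall_gt (h : ∀ δ, 0 < δ → HasLine α δ) {δ : ℝ} (hδ : 0 < δ)
    (hgt : ∀ δ', δ < δ' → HasLine (Option α) δ') : ∃ δ' < δ, HasLine (Option α) δ' := by
  classical
  obtain ⟨M₀, _, hM₀⟩ := h (δ / 4) (by positivity)
  have := Fintype.ofFinite M₀
  set cK : ℝ := ((Fintype.card (M₀ → Option α) : ℕ) : ℝ) with hcK
  have hcK0 : 0 < cK := by
    rw [hcK]
    exact_mod_cast Fintype.card_pos
  set θ := δ / 8 / cK with hθ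
  have hθ0 : 0 < θ := by positivity
  obtain ⟨e, he0, heθ, heδ⟩ : ∃ e, 0 < e ∧ e ≤ δ * θ / 32 ∧ e ≤ δ / 2 :=
    ⟨min (δ * θ / 32) (δ / 2), by positivity, min_le_left _ _, min_le_right _ _⟩
  obtain ⟨N, _, hN⟩ := hgt (δ + e) (by linarith)
  obtain ⟨I, _, hI⟩ := HasLine.avg_one_sub_prod_ind_mul_le h N he0
  obtain ⟨n, hn⟩ : ∃ n : ℕ, ((Nat.card α : ℝ) / (Nat.card α + 1)) ^ n < e := by
    refine exists_pow_lt_of_lt_one he0 ?_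
    rw [div_lt_one (by positivity)]
    linarith
  have hT : avg (ind {x : I ⊕ Fin n → Option α | ∀ i, x i ≠ none}) ≤ e := by
    rw [avg_ind_forall_ne_none]
    refine (pow_le_pow_of_le_one (by positivity) ?_ ?_).trans hn.le
    · rw [div_le_one (by positivity)]
      linarith
    · rw [Nat.card_sum, Nat.card_fin]
      exact Nat.le_add_left _ _
  have : Nonempty (M₀ ⊕ α) := (inferInstance : Nonempty α).map inr
  obtain ⟨M, _, hM⟩ := exists_free_coordinates (M₀ ⊕ α) (Option α) (I ⊕ Fin n) (θ / 4)
    (by positivity)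
  set c : ℝ := ((Nat.card (M → Option α) : ℕ) : ℝ) with hc
  have hc0 : 0 ≤ c := Nat.cast_nonneg _
  obtain ⟨e₁, he₁, hce₁⟩ : ∃ e₁, 0 < e₁ ∧ 2 * c * e₁ ≤ e := by
    refine ⟨e / (2 * c + 1), by positivity, ?_⟩
    rw [mul_div_assoc', div_le_iff₀ (by positivity)]
    nlinarith
  obtain ⟨N', _, hN'⟩ := hgt (δ + e₁) (by linarith)
  refine ⟨δ - e₁, by linarith, M ⊕ N', inferInstance, fun A hA => ?_⟩
  by_contra hline
  have hfibre : ∀ z : M → Option α, avg (fun y : N' → Option α => ind A (Sum.elim z y)) ≤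
      δ + e₁ := by
    intro z
    by_contra! hz
    apply hline
    refine ContainsLine.of_preimage_subst (W := Sum.elim (fun i => inl (z i)) inr)
      (fun e => ⟨inr e, rfl⟩) (hN' _ (hz.le.trans (avg_mono fun y =>
        le_of_eq (congrArg (ind A) ?_))))
    funext i
    cases i <;> rfl
  have hfibre' : ∀ z : M → Option α, δ - e ≤
      avg (fun y : N' → Option α => ind A (Sum.elim z y)) := by
    intro z
    rw [avg_sumElim] at hA
    have := le_of_le_avg hfibre hA z
    linarith
  let G : (M → Option α) → (N' → Option α) → ℝ := fun x y =>
    ∏ a, ind {x | Sum.elim (fill a x) y ∈ A} x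
  have hG0 : ∀ x y, 0 ≤ G x y := fun x y => Finset.prod_nonneg fun a _ => ind_nonneg _ _
  have hG1 : ∀ x y, G x y ≤ 1 := fun x y =>
    Finset.prod_le_one (fun a _ => ind_nonneg _ _) fun a _ => ind_le_one _ _
  let comp : (M → M₀ ⊕ α) → (M₀ → Option α) → M → Option α := fun U u i => Sum.elim u some (U i)
  have hsum : ∀ U : M → M₀ ⊕ α, δ / 4 ≤
      ∑ u : M₀ → Option α with ∃ i, u i = none, avg (G (comp U u)) := by
    intro U
    have h1 : δ / 2 ≤ avg fun z : M₀ → α => avg fun y : N' → Option α =>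
        ind A (Sum.elim (comp U fun i => some (z i)) y) :=
      le_avg fun z => le_trans (by linarith) (hfibre' _)
    rw [avg_comm] at h1
    have h2 : (avg fun y : N' → Option α => avg fun z : M₀ → α =>
        ind A (Sum.elim (comp U fun i => some (z i)) y)) ≤ avg fun y => δ / 4 +
          ∑ u : M₀ → Option α with ∃ i, u i = none, G (comp U u) y := by
      refine avg_mono fun y => ?_
      by_cases hy : δ / 4 ≤ avg fun z : M₀ → α =>
        ind A (Sum.elim (comp U fun i => some (z i)) y)
      · obtain ⟨u, hu, huA⟩ := hM₀ {z | Sum.elim (comp U fun i => some (z i)) y ∈ A} hy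
        have h3 := Finset.single_le_sum (f := fun u => G (comp U u) y) (fun u _ => hG0 _ _)
          (show u ∈ Finset.univ.filter (fun u : M₀ → Option α => ∃ i, u i = none) by simpa using hu)
        have h4 : G (comp U u) y = 1 := by
          refine Finset.prod_eq_one fun a _ => ind_of_mem ?_
          have h5 : Sum.elim (comp U fun i => some ((u i).getD a)) y ∈ A := huA a
          have h6 : fill a (comp U u) = comp U fun i => some ((u i).getD a) := by
            funext i
            simp only [comp, fill]
            cases U i <;> rfl
          simpa only [Set.mem_ofPred_eq, h6] using h5
        simp only [h4] at h3
        have h5 : (avg fun z : M₀ → α => ind A (Sum.elim (comp U fun i => some (z i)) y)) ≤ 1 :=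
          avg_le fun z => ind_le_one _ _
        linarith
      · have : 0 ≤ ∑ u : M₀ → Option α with ∃ i, u i = none, G (comp U u) y :=
          Finset.sum_nonneg fun u _ => hG0 _ _
        linarith
    rw [avg_add, avg_const, avg_sum] at h2
    linarith
  obtain ⟨u, ⟨j, hj⟩, hu⟩ : ∃ u : M₀ → Option α, (∃ i, u i = none) ∧
      θ ≤ avg fun U => avg (G (comp U u)) := by
    by_contra! hlt
    have h1 := le_avg hsum
    rw [avg_sum] at h1
    have h2 : ∑ u : M₀ → Option α with ∃ i, u i = none, (avg fun U => avg (G (comp U u))) ≤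
        ∑ u : M₀ → Option α with ∃ i, u i = none, θ :=
      Finset.sum_le_sum fun u hu => (hlt u (by simpa using hu)).le
    have h3 : ∑ u : M₀ → Option α with ∃ i, u i = none, θ ≤ ∑ u : M₀ → Option α, θ :=
      Finset.sum_le_sum_of_subset_of_nonneg (Finset.filter_subset _ _) fun _ _ _ => hθ0.le
    have h4 : ∑ u : M₀ → Option α, θ = δ / 8 := by
      rw [Finset.sum_const, Finset.card_univ, nsmul_eq_mul, ← hcK, hθ, mul_div_cancel₀ _ hcK0.ne']
    linarith
  let φ : Option α → M₀ ⊕ α := fun o => o.elim (inl j) inr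
  have hφ : φ.Injective := by
    intro a b hab
    cases a <;> cases b <;> simp_all [φ]
  obtain ⟨W₀, hW₀, hW₀θ⟩ : ∃ W : M → (M₀ ⊕ α) ⊕ (I ⊕ Fin n), Proper W ∧
      θ / 2 ≤ avg fun x => avg (G (comp (subst W φ x) u)) := by
    by_contra! hlt
    have := hM φ hφ (fun U => avg (G (comp U u))) (fun U => avg_le (hG1 _)) (θ / 2)
      (by positivity) fun W hW => (hlt W hW).le
    linarith
  let W : M → Option α ⊕ (I ⊕ Fin n) := fun i => (W₀ i).map (Sum.elim u some) id
  have hW : Proper W := fun e => by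
    obtain ⟨i, hi⟩ := hW₀ e
    exact ⟨i, by simp [W, hi]⟩
  have hWcomp : ∀ x, comp (subst W₀ φ x) u = subst W id x := by
    intro x
    funext i
    simp only [comp, subst, W]
    cases W₀ i with
    | inl s => rfl
    | inr k =>
      simp only [Sum.elim_inr, Function.comp, Sum.map_inr, φ, id]
      cases x k <;> simp [hj]
  simp only [hWcomp] at hW₀θ
  have hy : ∀ y : N' → Option α, avg (fun x => ind A (Sum.elim (subst W id x) y)) +
      δ * avg (fun x => G (subst W id x) y) ≤ δ + 3 * e := by
    intro y
    refine avg_add_mul_avg_prod_le hδ he0 hI hT hN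
      (A := {x | Sum.elim (subst W id x) y ∈ A}) (fun hl => hline ?_)
      (P := fun a => {x | Sum.elim (fill a (subst W id x)) y ∈ A}) (fun a x x' hxx hx => ?_)
      fun x hx hxA => ?_
    · refine ContainsLine.of_preimage_subst (W := Sum.elim W (fun i => inl (y i))) (fun e => ?_) ?_
      · obtain ⟨i, hi⟩ := hW e
        exact ⟨inl i, hi⟩
      · convert hl using 3 with x
        refine iff_of_eq (congrArg (· ∈ A) ?_)
        funext i
        cases i <;> rfl
    · have : fill a (subst W id x) = fill a (subst W id x') := by
        funext i
        simp only [fill, subst]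
        cases W i with
        | inl s => rfl
        | inr e => exact congrArg some (hxx e)
      rw [Set.mem_ofPred_eq] at hx ⊢
      rwa [← this]
    · by_contra! hall
      have hsub : ∀ z : M → Option α,
          subst (Sum.elim inr (fun i => inl (y i))) id z = Sum.elim z y := by
        intro z
        funext i
        cases i <;> rfl
      obtain ⟨e, he⟩ := hx
      obtain ⟨i, hi⟩ := hW e
      apply hline
      refine ContainsLine.of_preimage_subst (W := Sum.elim inr (fun i => inl (y i)))
        (fun i => ⟨inl i, rfl⟩) (containsLine_of_fill_mem (x := subst W id x)
          ⟨i, by simp [subst, hi, he]⟩ ?_ fun a => ?_)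
      · rw [Set.mem_ofPred_eq, hsub]
        exact hxA
      · rw [Set.mem_ofPred_eq, hsub]
        exact hall a
  have h1 := avg_le hy
  rw [avg_add, avg_const_mul, avg_comm, avg_comm (fun y x => G (subst W id x) y)] at h1
  have h2 : δ - e ≤ avg fun x => avg fun y => ind A (Sum.elim (subst W id x) y) :=
    le_avg fun x => hfibre' _
  nlinarith

end densityIncrement

lemma HasLine.mono {α : Type} {δ δ' : ℝ} (h : HasLine α δ) (hδ : δ ≤ δ') : HasLine α δ' := by
  obtain ⟨M, _, hM⟩ := h
  exact ⟨M, inferInstance, fun A hA => hM A (hδ.trans hA)⟩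

lemma hasLine_of_subsingleton (α : Type) [Finite α] [Subsingleton α] {δ : ℝ} (hδ : 0 < δ) :
    HasLine α δ := by
  refine ⟨Unit, inferInstance, fun A hA => ?_⟩
  obtain ⟨x, hx⟩ := exists_mem_of_avg_ind_pos (hδ.trans_le hA)
  exact ⟨fun _ => none, ⟨(), rfl⟩, fun a => by rwa [Subsingleton.elim (fun _ => _) x]⟩

lemma HasLine.option {α : Type} [Fintype α] [Nonempty α] (h : ∀ δ, 0 < δ → HasLine α δ)
    {δ : ℝ} (hδ : 0 < δ) : HasLine (Option α) δ := by
  set D : Set ℝ := {δ | 0 < δ ∧ HasLine (Option α) δ} with hD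
  have hne : D.Nonempty := by
    refine ⟨2, two_pos, Unit, inferInstance, fun A hA => ?_⟩
    have : avg (ind A) ≤ 1 := avg_le (ind_le_one A)
    linarith
  have hbdd : BddBelow D := ⟨0, fun x hx => hx.1.le⟩
  have hgt : ∀ δ', sInf D < δ' → HasLine (Option α) δ' := by
    intro δ' hδ'
    obtain ⟨d, hd, hdδ'⟩ := exists_lt_of_csInf_lt hne hδ'
    exact hd.2.mono hdδ'.le
  refine hgt δ (lt_of_le_of_lt ?_ hδ)
  by_contra! hpos
  obtain ⟨d, hd, hdD⟩ := HasLine.exists_lt_of_forall_gt h hpos hgt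
  have := csInf_le hbdd (a := max d (sInf D / 2))
    ⟨lt_max_of_lt_right (by positivity), hdD.mono (le_max_left _ _)⟩
  rcases le_max_iff.1 this with h1 | h1 <;> linarith

lemma exists_surjective_hasLine (k : ℕ) : ∃ (α : Type) (_ : Finite α) (_ : Nonempty α),
    (∀ δ, 0 < δ → HasLine α δ) ∧ ∃ f : α → Option (Fin k), f.Surjective := by
  induction k with
  | zero =>
    exact ⟨Unit, inferInstance, inferInstance, fun δ => hasLine_of_subsingleton Unit,
      fun _ => none, fun o => ⟨(), Subsingleton.elim _ _⟩⟩
  | succ k ih =>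
    obtain ⟨α, _, _, h, f, hf⟩ := ih
    have := Fintype.ofFinite α
    refine ⟨Option α, inferInstance, inferInstance, fun δ => HasLine.option h,
      fun o => o.map fun a => (finSuccEquiv k).symm (f a), ?_⟩
    rintro (_ | i)
    · exact ⟨none, rfl⟩
    · obtain ⟨a, ha⟩ := hf (finSuccEquiv k i)
      exact ⟨some a, by simp [ha]⟩

lemma exists_mem_pow_mem {X G : Type*} [MeasurableSpace X] [CommMonoid G]
    (π : G →* Function.End X) (μ : Measure X) [IsProbabilityMeasure μ]
    (hπ : ∀ g, MeasurePreserving (π g) μ μ) {k : ℕ} (S : Fin k → G) {B : Set X}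
    (hB : MeasurableSet B) (hμB : μ B ≠ 0) :
    ∃ y ∈ B, ∃ r : ℕ, 1 ≤ r ∧ ∀ i, π (S i ^ r) y ∈ B := by
  classical
  obtain ⟨α, _, _, hα, f, hf⟩ := exists_surjective_hasLine k
  have hpos : 0 < μ.real B := ENNReal.toReal_pos hμB (measure_ne_top μ B)
  obtain ⟨M, _, hM⟩ := hα (μ.real B / 2) (by positivity)
  have := Fintype.ofFinite M
  have := Fintype.ofFinite α
  let s : α → G := fun a => (f a).elim 1 S
  obtain ⟨x, hx⟩ : ∃ x, μ.real B / 2 ≤ avg fun w : M → α => ind B (π (∏ i, s (w i)) x) := by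
    by_contra! hlt
    have hind : ind B = B.indicator fun _ => 1 := by
      funext x
      simp only [ind, Set.indicator]
    have hint : ∀ g, Integrable (fun x => ind B (π g x)) μ := fun g => by
      rw [hind]
      exact (hπ g).integrable_comp_of_integrable ((integrable_const _).indicator hB)
    have h1 : ∀ g, ∫ x, ind B (π g x) ∂μ = μ.real B := fun g => by
      have h2 : (fun x => ind B (π g x)) = (π g ⁻¹' B).indicator fun _ => 1 := by
        rw [hind]
        rfl
      rw [h2, integral_indicator_const _ ((hπ g).measurable hB), smul_eq_mul, mul_one,
        measureReal_def,
        (hπ g).measure_preimage hB.nullMeasurableSet, measureReal_def]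
    have h2 : ∫ x, (avg fun w : M → α => ind B (π (∏ i, s (w i)) x)) ∂μ = μ.real B := by
      simp only [avg_eq]
      rw [integral_div, integral_finsetSum _ fun w _ => hint _]
      simp only [h1, ← avg_eq, avg_const]
    have h3 : ∫ x, (avg fun w : M → α => ind B (π (∏ i, s (w i)) x)) ∂μ ≤
        ∫ _, μ.real B / 2 ∂μ := by
      refine integral_mono ?_ (integrable_const _) fun x => (hlt x).le
      simp only [avg_eq]
      exact (integrable_finsetSum _ fun w _ => hint _).div_const _
    rw [h2, integral_const, probReal_univ, one_smul] at h3
    linarith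
  obtain ⟨u, ⟨j, hj⟩, hu⟩ := hM {w | π (∏ i, s (w i)) x ∈ B} hx
  have key : ∀ a, ∏ i, s ((u i).getD a) =
      s a ^ (Finset.univ.filter fun i => u i = none).card * ∏ i, (u i).elim 1 s := by
    intro a
    rw [← Finset.prod_const, Finset.prod_filter, ← Finset.prod_mul_distrib]
    refine Finset.prod_congr rfl fun i _ => ?_
    cases u i <;> simp
  have hu' : ∀ a, π (s a ^ (Finset.univ.filter fun i => u i = none).card)
      (π (∏ i, (u i).elim 1 s) x) ∈ B := by
    intro a
    have := hu a
    rw [Set.mem_ofPred_eq, key, map_mul] at this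
    exact this
  refine ⟨π (∏ i, (u i).elim 1 s) x, ?_, (Finset.univ.filter fun i => u i = none).card,
    Finset.card_pos.2 ⟨j, by simpa using hj⟩, fun i => ?_⟩
  · obtain ⟨a, ha⟩ := hf none
    have := hu' a
    simp only [s, ha, Option.elim_none, one_pow, map_one] at this
    exact this
  · obtain ⟨a, ha⟩ := hf (some i)
    have := hu' a
    simp only [s, ha, Option.elim_some] at this
    exact this

end DensityHalesJewett

/-- Pointwise form of the Furstenberg multiple recurrence theorem: for pairwise commuting
measurable measure-preserving maps `T 1, …, T k` on a probability space and a measurable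
set `A` with `μ A > 0`, almost every `x ∈ A` satisfies `x ∈ ⋂ i, (T i)^{-n} A` for
some `n ≥ 1`. -/
theorem furstenberg_multiple_recurrence_pointwise {X : Type*} [MeasurableSpace X]
    (μ : Measure X) [IsProbabilityMeasure μ] (k : ℕ) (hk : 1 ≤ k) (T : Fin k → X → X)
    (hTmeas : ∀ i, Measurable (T i))
    (hTpres : ∀ i, ∀ A : Set X, MeasurableSet A → μ (T i ⁻¹' A) = μ A)
    (hTcomm : ∀ i j, T i ∘ T j = T j ∘ T i)
    (A : Set X) (hA : MeasurableSet A) (hApos : 0 < μ A) :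
    ∀ᵐ x ∂μ, x ∈ A → ∃ n : ℕ, 1 ≤ n ∧ x ∈ ⋂ i : Fin k, (T i)^[n] ⁻¹' A := by
  let R : Set (Function.End X) := Set.range T
  have : IsMulCommutative (Submonoid.closure R) := Submonoid.isMulCommutative_closure _ (by
    rintro _ ⟨i, rfl⟩ _ ⟨j, rfl⟩
    exact hTcomm i j)
  let π : Submonoid.closure R →* Function.End X := (Submonoid.closure R).subtype
  have hπ : ∀ g, MeasurePreserving (π g) μ μ := by
    rintro ⟨g, hg⟩
    change MeasurePreserving g μ μ
    induction hg using Submonoid.closure_induction with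
    | mem g hg =>
      obtain ⟨i, rfl⟩ := hg
      refine ⟨hTmeas i, Measure.ext fun B hB => ?_⟩
      rw [Measure.map_apply (hTmeas i) hB, hTpres i B hB]
    | one => exact MeasurePreserving.id μ
    | mul g h _ _ ihg ihh => exact ihg.comp ihh
  have hS : ∀ i, T i ∈ Submonoid.closure R := fun i => Submonoid.subset_closure ⟨i, rfl⟩
  have hpow : ∀ i (r : ℕ) (y : X),
      π ((⟨T i, hS i⟩ : Submonoid.closure R) ^ r) y = (T i)^[r] y := by
    intro i r y
    rw [map_pow]
    induction r with
    | zero => rfl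
    | succ r ih =>
      rw [pow_succ', Function.iterate_succ_apply', ← ih]
      rfl
  let B : Set X := A ∩ ⋂ n : ℕ, ⋂ (_ : 1 ≤ n), (⋂ i, (T i)^[n] ⁻¹' A)ᶜ
  have hB : MeasurableSet B := hA.inter <| .iInter fun n => .iInter fun _ =>
    (MeasurableSet.iInter fun i => ((hTmeas i).iterate n) hA).compl
  have hμB : μ B = 0 := by
    by_contra hμB
    open scoped IsMulCommutative in
    obtain ⟨y, hy, r, hr, hyr⟩ := DensityHalesJewett.exists_mem_pow_mem
      (G := Submonoid.closure R) π μ hπ (fun i => ⟨T i, hS i⟩) hB hμB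
    refine Set.mem_iInter₂.1 hy.2 r hr (Set.mem_iInter.2 fun i => ?_)
    have := (hyr i).1
    rwa [hpow] at this
  filter_upwards [measure_eq_zero_iff_ae_notMem.1 hμB] with x hx hxA
  by_contra! h
  exact hx ⟨hxA, Set.mem_iInter₂.2 h⟩
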